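/- Evaluation of the UCC sum-rate bound for the binary double dirty QMSTx: Consider the binary double dirty QMSTx of Example 1 with θ ∈ [0,π/2) and τ ∈ (0,1/2). Choose 𝒱₁=𝒱₂=F₂ and p_{X_jV_j|S_j}(1, 1⊕s_j | s_j) = τ = 1 − p_{X_jV_j|S_j}(0, s_j | s_j) for j=1,2, and let σ be the corresponding classical-quantum state of Theorem 2 (with W = V₁⊕V₂). Then H(V_j|S_j)_σ = h_b(τ) for j=1,2 and min{H(V₁|S₁)_σ, H(V₂|S₂)_σ} − H(V₁⊕V₂ | Y)_σ = α − 1 + h_b(τ), where α = h̃_b((1−2τ)² sin θ) − h̃_b(√(1−4ε(1−ε) sin²θ)) with ε = 2τ(1−τ). -/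

import Mathlib

open scoped BigOperators
open Matrix Filter
open scoped ComplexOrder

noncomputable section
attribute [local instance] Classical.propDecidable

/-- `-(x log₂ x)`. -/
def nlog2 (x : ℝ) : ℝ := -(x * Real.logb 2 x)

/-- von Neumann entropy (base 2) of a matrix (0 if not Hermitian). -/
def matEnt2 {d : ℕ} (A : Matrix (Fin d) (Fin d) ℂ) : ℝ :=
  if h : A.IsHermitian then ∑ i, nlog2 (h.eigenvalues i) else 0

/-- marginal of a cq state over the classical index, grouping blocks along `f`. -/
def cqMarg {C C' : Type*} [Fintype C] {d : ℕ} (f : C → C')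
    (σ : C → Matrix (Fin d) (Fin d) ℂ) : C' → Matrix (Fin d) (Fin d) ℂ :=
  fun c' => ∑ c, if f c = c' then σ c else 0

/-- entropy (base 2) of a cq state (classical indices + quantum register). -/
def cqEnt2 {C : Type*} [Fintype C] {d : ℕ} (σ : C → Matrix (Fin d) (Fin d) ℂ) : ℝ :=
  ∑ c, matEnt2 (σ c)

/-- entropy (base 2) of the classical part (quantum register traced out). -/
def cEnt2 {C : Type*} [Fintype C] {d : ℕ} (σ : C → Matrix (Fin d) (Fin d) ℂ) : ℝ :=
  ∑ c, nlog2 ((σ c).trace.re)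

/-- entropy (base 2) of the quantum register alone. -/
def entQ2 {C : Type*} [Fintype C] {d : ℕ} (σ : C → Matrix (Fin d) (Fin d) ℂ) : ℝ :=
  matEnt2 (∑ c, σ c)

/-- `H(f(C))_σ` (base 2): entropy of a classical marginal (quantum traced out). -/
def margEntC2 {C C' : Type*} [Fintype C] [Fintype C'] {d : ℕ} (f : C → C')
    (σ : C → Matrix (Fin d) (Fin d) ℂ) : ℝ := cEnt2 (cqMarg f σ)

/-- `H(f(C), Y)_σ` (base 2): classical marginal together with the quantum register. -/
def margEntCQ2 {C C' : Type*} [Fintype C] [Fintype C'] {d : ℕ} (f : C → C')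
    (σ : C → Matrix (Fin d) (Fin d) ℂ) : ℝ := cqEnt2 (cqMarg f σ)

/-- rank-one projector `|v⟩⟨v|`. -/
def outer {d : ℕ} (v : Fin d → ℂ) : Matrix (Fin d) (Fin d) ℂ :=
  Matrix.of fun i j => v i * star (v j)

lemma outer_posSemidef {d : ℕ} (v : Fin d → ℂ) : (outer v).PosSemidef := by
  have h : outer v
      = (Matrix.of fun (_ : Fin 1) j => star (v j))ᴴ * (Matrix.of fun (_ : Fin 1) j => star (v j)) := by
    ext i j
    simp [outer, Matrix.mul_apply, Matrix.conjTranspose_apply, Fin.sum_univ_one]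
  rw [h]
  exact Matrix.posSemidef_conjTranspose_mul_self _

/-- `|v_θ⟩ = (cos θ, sin θ)ᵀ`. -/
def vth (θ : ℝ) : Fin 2 → ℂ := ![(Real.cos θ : ℂ), (Real.sin θ : ℂ)]
/-- `|v_θ^⊥⟩ = (sin θ, −cos θ)ᵀ`. -/
def vthp (θ : ℝ) : Fin 2 → ℂ := ![(Real.sin θ : ℂ), -(Real.cos θ : ℂ)]
def ket0 : Fin 2 → ℂ := ![1, 0]
def ket1 : Fin 2 → ℂ := ![0, 1]

lemma outer_trace {d : ℕ} (v : Fin d → ℂ) : (outer v).trace = ∑ i, v i * star (v i) := by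
  simp [outer, Matrix.trace, Matrix.diag]

lemma trace_outer_vth (θ : ℝ) : (outer (vth θ)).trace = 1 := by
  rw [outer_trace]
  simp only [vth, Fin.sum_univ_two, Matrix.cons_val_zero, Matrix.cons_val_one, Matrix.head_cons,
    Complex.star_def]
  rw [Complex.conj_ofReal, Complex.conj_ofReal]
  norm_cast
  nlinarith [Real.cos_sq_add_sin_sq θ]

lemma trace_outer_vthp (θ : ℝ) : (outer (vthp θ)).trace = 1 := by
  rw [outer_trace]
  simp only [vthp, Fin.sum_univ_two, Matrix.cons_val_zero, Matrix.cons_val_one, Matrix.head_cons,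
    Complex.star_def, map_neg, Complex.conj_ofReal, mul_neg, neg_mul, neg_neg]
  norm_cast
  nlinarith [Real.cos_sq_add_sin_sq θ]

lemma trace_outer_ket0 : (outer ket0).trace = 1 := by
  rw [outer_trace]; simp [ket0, Fin.sum_univ_two]

lemma trace_outer_ket1 : (outer ket1).trace = 1 := by
  rw [outer_trace]; simp [ket1, Fin.sum_univ_two]

/-- The density operators of Example 1: `γ(x₁⊕x₂, s₁⊕s₂)`. -/
def gammaEx (θ : ℝ) : Bool → Bool → Matrix (Fin 2) (Fin 2) ℂ :=
  fun w t =>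
    match w, t with
    | false, false => outer ket0
    | false, true  => outer (vthp θ)
    | true,  false => outer ket1
    | true,  true  => outer (vth θ)

lemma gammaEx_psd (θ : ℝ) (w t : Bool) : (gammaEx θ w t).PosSemidef := by
  cases w <;> cases t <;> exact outer_posSemidef _

lemma gammaEx_tr (θ : ℝ) (w t : Bool) : (gammaEx θ w t).trace = 1 := by
  cases w <;> cases t <;>
    simp [gammaEx, trace_outer_ket0, trace_outer_ket1, trace_outer_vth, trace_outer_vthp]

/-- Binary entropy function (base 2). -/
def hb (x : ℝ) : ℝ := -(x * Real.logb 2 x) - ((1 - x) * Real.logb 2 (1 - x))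

/-- `h̃_b(x) = h_b(1/2 + x/2)`. -/
def htb (x : ℝ) : ℝ := hb (1/2 + x/2)

/-- The quantity `α` of the paper: `α = h̃_b((1−2τ)² sin θ) − h̃_b(√(1−4ε(1−ε)sin²θ))`
with `ε = 2τ(1−τ)`. -/
def alphaEx (τ θ : ℝ) : ℝ :=
  htb ((1 - 2*τ)^2 * Real.sin θ)
    - htb (Real.sqrt (1 - 4 * (2*τ*(1-τ)) * (1 - 2*τ*(1-τ)) * (Real.sin θ)^2))

/-- `p_{X_jV_j|S_j}` of Proposition 3: `(X,V) = (1, 1⊕s)` w.p. `τ` and `(0, s)` w.p. `1−τ`. -/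
def pXVex (τ : ℝ) (s : Bool) (xv : Bool × Bool) : ℝ :=
  if xv = (true, !s) then τ else if xv = (false, s) then 1 - τ else 0

/-- The test cq state of Theorem 2 evaluated for Example 1 with the linear-coding choice;
classical registers `(x₁,x₂,v₁,v₂,w,s₁,s₂)` with `w = v₁ ⊕ v₂`. -/
def sigma14 (θ τ : ℝ) :
    Bool × Bool × Bool × Bool × Bool × Bool × Bool → Matrix (Fin 2) (Fin 2) ℂ :=
  fun c => match c with
  | (x₁, x₂, v₁, v₂, w, s₁, s₂) =>
      (((1/4 : ℝ) * pXVex τ s₁ (x₁, v₁) * pXVex τ s₂ (x₂, v₂)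
          * (if w = xor v₁ v₂ then 1 else 0) : ℝ) : ℂ)
        • gammaEx θ (xor x₁ x₂) (xor s₁ s₂)

lemma matEnt2_fin_two {A : Matrix (Fin 2) (Fin 2) ℂ} (hA : A.IsHermitian) {a b : ℝ}
    (htr : A.trace = ((a + b : ℝ) : ℂ)) (hdet : A.det = ((a * b : ℝ) : ℂ)) :
    matEnt2 A = nlog2 a + nlog2 b := by
  rw [matEnt2, dif_pos hA, Fin.sum_univ_two]
  have hsum : hA.eigenvalues 0 + hA.eigenvalues 1 = a + b := by
    have h := hA.trace_eq_sum_eigenvalues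
    rw [htr, Fin.sum_univ_two] at h
    apply Complex.ofReal_injective
    simpa using h.symm
  have hprod : hA.eigenvalues 0 * hA.eigenvalues 1 = a * b := by
    have h := hA.det_eq_prod_eigenvalues
    rw [hdet, Fin.prod_univ_two] at h
    apply Complex.ofReal_injective
    simpa using h.symm
  have hroot : (hA.eigenvalues 0 - a) * (hA.eigenvalues 0 - b) = 0 := by
    linear_combination hA.eigenvalues 0 * hsum - hprod
  rcases mul_eq_zero.mp hroot with h | h
  · rw [show hA.eigenvalues 0 = a by linarith, show hA.eigenvalues 1 = b by linarith]
  · rw [show hA.eigenvalues 0 = b by linarith, show hA.eigenvalues 1 = a by linarith, add_comm]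

lemma nlog2_half (p : ℝ) : nlog2 (p / 2) = (nlog2 p + p) / 2 := by
  rcases eq_or_ne p 0 with rfl | hp
  · simp [nlog2]
  · rw [nlog2, nlog2, Real.logb_div hp two_ne_zero, Real.logb_self_eq_one one_lt_two]
    ring

lemma nlog2_add_nlog2_one_sub (p : ℝ) : nlog2 p + nlog2 (1 - p) = hb p := by
  rw [nlog2, nlog2, hb]
  ring

lemma nlog2_half_add_nlog2_half_one_sub (p : ℝ) :
    nlog2 (p / 2) + nlog2 ((1 - p) / 2) = (hb p + 1) / 2 := by
  rw [nlog2_half, nlog2_half, ← nlog2_add_nlog2_one_sub]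
  ring

lemma matEnt2_eq_htb {A : Matrix (Fin 2) (Fin 2) ℂ} (hA : A.IsHermitian) {r : ℝ}
    (htr : A.trace = 1) (hdet : A.det = (((1 - r ^ 2) / 4 : ℝ) : ℂ)) :
    matEnt2 A = htb r := by
  rw [htb, ← nlog2_add_nlog2_one_sub]
  refine matEnt2_fin_two hA ?_ ?_
  · rw [htr]; push_cast; ring
  · rw [hdet]; push_cast; ring

lemma matEnt2_eq_htb_of_trace_half {A : Matrix (Fin 2) (Fin 2) ℂ} (hA : A.IsHermitian) {r : ℝ}
    (htr : A.trace = 1 / 2) (hdet : A.det = (((1 - r ^ 2) / 16 : ℝ) : ℂ)) :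
    matEnt2 A = (htb r + 1) / 2 := by
  rw [htb, ← nlog2_half_add_nlog2_half_one_sub]
  refine matEnt2_fin_two hA ?_ ?_
  · rw [htr]; push_cast; ring
  · rw [hdet]; push_cast; ring

lemma isHermitian_sigma14 (θ τ : ℝ) (c : Bool × Bool × Bool × Bool × Bool × Bool × Bool) :
    (sigma14 θ τ c).IsHermitian := by
  obtain ⟨x₁, x₂, v₁, v₂, w, s₁, s₂⟩ := c
  exact (gammaEx_psd θ _ _).isHermitian.smul (Complex.conj_ofReal _)

lemma isHermitian_cqMarg_sigma14 (θ τ : ℝ) {C' : Type*}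
    (f : Bool × Bool × Bool × Bool × Bool × Bool × Bool → C') (c' : C') :
    (cqMarg f (sigma14 θ τ) c').IsHermitian := by
  refine isSelfAdjoint_sum _ fun c _ => ?_
  split_ifs
  · exact isHermitian_sigma14 θ τ c
  · exact IsSelfAdjoint.zero _

lemma cqMarg_sigma14 (θ τ : ℝ) {C' : Type*}
    (f : Bool × Bool × Bool × Bool × Bool × Bool × Bool → C') (c' : C') :
    cqMarg f (sigma14 θ τ) c' = ∑ x₁, ∑ x₂, ∑ s₁, ∑ s₂,
      if f (x₁, x₂, xor x₁ s₁, xor x₂ s₂, xor (xor x₁ s₁) (xor x₂ s₂), s₁, s₂) = c' then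
        (((1/4 : ℝ) * (if x₁ then τ else 1 - τ) * (if x₂ then τ else 1 - τ) : ℝ) : ℂ) •
          gammaEx θ (xor x₁ x₂) (xor s₁ s₂)
      else 0 := by
  simp [cqMarg, sigma14, Fintype.sum_prod_type, pXVex, -ite_smul]
  abel

lemma trace_cqMarg_sigma14 (θ τ : ℝ) {C' : Type*}
    (f : Bool × Bool × Bool × Bool × Bool × Bool × Bool → C') (c' : C') :
    (cqMarg f (sigma14 θ τ) c').trace.re = ∑ x₁, ∑ x₂, ∑ s₁, ∑ s₂,
      if f (x₁, x₂, xor x₁ s₁, xor x₂ s₂, xor (xor x₁ s₁) (xor x₂ s₂), s₁, s₂) = c' then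
        (1/4 : ℝ) * (if x₁ then τ else 1 - τ) * (if x₂ then τ else 1 - τ)
      else 0 := by
  simp only [cqMarg_sigma14, Matrix.trace_sum, Complex.re_sum]
  refine Finset.sum_congr rfl fun x₁ _ => Finset.sum_congr rfl fun x₂ _ =>
    Finset.sum_congr rfl fun s₁ _ => Finset.sum_congr rfl fun s₂ _ => ?_
  split_ifs <;> simp [gammaEx_tr, Matrix.trace_smul]

lemma cqMarg_xor_sigma14 (θ τ : ℝ) (w : Bool) :
    cqMarg (fun c => c.2.2.2.2.1) (sigma14 θ τ) w =
      ((((1 - 2 * τ * (1 - τ)) / 2 : ℝ) : ℂ) • gammaEx θ false w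
        + ((2 * τ * (1 - τ) / 2 : ℝ) : ℂ) • gammaEx θ true (!w)) := by
  rw [cqMarg_sigma14]
  cases w <;> simp <;> module

lemma cos_sq_ofReal (θ : ℝ) : Complex.cos θ ^ 2 = 1 - Complex.sin θ ^ 2 := by
  rw [← Complex.sin_sq_add_cos_sq (θ : ℂ)]
  ring

lemma det_gammaEx_mix (θ p : ℝ) (w : Bool) :
    ((((1 - p) / 2 : ℝ) : ℂ) • gammaEx θ false w
        + ((p / 2 : ℝ) : ℂ) • gammaEx θ true (!w)).det =
      ((p * (1 - p) * Real.sin θ ^ 2 / 4 : ℝ) : ℂ) := by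
  cases w <;>
    simp [Matrix.det_fin_two, gammaEx, outer, ket0, ket1, vth, vthp, ← Complex.cos_conj,
      ← Complex.sin_conj] <;>
    ring

lemma det_sum_gammaEx_mix (θ p : ℝ) :
    (∑ w, ((((1 - p) / 2 : ℝ) : ℂ) • gammaEx θ false w
        + ((p / 2 : ℝ) : ℂ) • gammaEx θ true (!w))).det =
      (((1 - ((1 - 2 * p) * Real.sin θ) ^ 2) / 4 : ℝ) : ℂ) := by
  simp [Matrix.det_fin_two, gammaEx, outer, ket0, ket1, vth, vthp, ← Complex.cos_conj,
      ← Complex.sin_conj]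
  ring_nf
  have hcos := cos_sq_ofReal θ
  have hcos4 : Complex.cos θ ^ 4 = (1 - Complex.sin θ ^ 2) ^ 2 := by rw [← hcos]; ring
  simp only [hcos, hcos4]
  ring

lemma sum_sigma14 (θ τ : ℝ) :
    ∑ c, sigma14 θ τ c =
      ∑ w, cqMarg (fun c => c.2.2.2.2.1) (sigma14 θ τ) w := by
  simp only [cqMarg]
  rw [Finset.sum_comm]
  refine Finset.sum_congr rfl fun ⟨x₁, x₂, v₁, v₂, w, s₁, s₂⟩ _ => ?_
  cases w <;> simp

lemma entQ2_sigma14 (θ τ : ℝ) :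
    entQ2 (sigma14 θ τ) = htb ((1 - 2 * τ) ^ 2 * Real.sin θ) := by
  refine matEnt2_eq_htb (isSelfAdjoint_sum _ fun c _ => isHermitian_sigma14 θ τ c) ?_ ?_
  · simp [sum_sigma14, cqMarg_xor_sigma14, Matrix.trace_smul, gammaEx_tr]
    ring
  · simp only [sum_sigma14, cqMarg_xor_sigma14, det_sum_gammaEx_mix]
    congr 3
    ring

lemma margEntCQ2_sigma14 (θ τ : ℝ) :
    margEntCQ2 (fun c => c.2.2.2.2.1) (sigma14 θ τ) =
      1 + htb (Real.sqrt (1 - 4 * (2*τ*(1-τ)) * (1 - 2*τ*(1-τ)) * (Real.sin θ)^2)) := by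
  set r := Real.sqrt (1 - 4 * (2*τ*(1-τ)) * (1 - 2*τ*(1-τ)) * (Real.sin θ)^2) with hr
  have hr2 : r ^ 2 = 1 - 4 * (2*τ*(1-τ)) * (1 - 2*τ*(1-τ)) * (Real.sin θ)^2 := by
    refine Real.sq_sqrt ?_
    nlinarith [Real.sin_sq_le_one θ, sq_nonneg ((1 - 2 * (2*τ*(1-τ))) * Real.sin θ)]
  have hw (w : Bool) : matEnt2 (cqMarg (fun c => c.2.2.2.2.1) (sigma14 θ τ) w)
      = (htb r + 1) / 2 := by
    refine matEnt2_eq_htb_of_trace_half (isHermitian_cqMarg_sigma14 θ τ _ w) ?_ ?_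
    · simp [cqMarg_xor_sigma14, Matrix.trace_smul, gammaEx_tr]
      ring
    · rw [cqMarg_xor_sigma14, det_gammaEx_mix, hr2]
      congr 1
      ring
  simp only [margEntCQ2, cqEnt2, hw, Fintype.sum_bool]
  ring

lemma condEnt_eq_hb (τ : ℝ) :
    nlog2 (1 / 2 + τ * (-1 / 2)) * 2 + nlog2 (τ * (1 / 2)) * 2 - nlog2 (1 / 2) * 2 = hb τ := by
  have hone : nlog2 1 = 0 := by simp [nlog2]
  rw [show 1 / 2 + τ * (-1 / 2) = (1 - τ) / 2 by ring, show τ * (1 / 2) = τ / 2 by ring]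
  linarith [nlog2_half_add_nlog2_half_one_sub τ, nlog2_half 1]

lemma condEnt_fst (θ τ : ℝ) :
    margEntC2 (fun c => (c.2.2.1, c.2.2.2.2.2.1)) (sigma14 θ τ)
      - margEntC2 (fun c => c.2.2.2.2.2.1) (sigma14 θ τ) = hb τ := by
  rw [← condEnt_eq_hb]
  simp [margEntC2, cEnt2, trace_cqMarg_sigma14, Fintype.sum_prod_type]
  ring_nf

lemma condEnt_snd (θ τ : ℝ) :
    margEntC2 (fun c => (c.2.2.2.1, c.2.2.2.2.2.2)) (sigma14 θ τ)
      - margEntC2 (fun c => c.2.2.2.2.2.2) (sigma14 θ τ) = hb τ := by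
  rw [← condEnt_eq_hb]
  simp [margEntC2, cEnt2, trace_cqMarg_sigma14, Fintype.sum_prod_type]
  ring_nf

/-- Evaluation of the UCC sum-rate bound for the binary double dirty QMSTx:
`H(V_j|S_j)_σ = h_b(τ)` for `j = 1,2`, and
`min{H(V₁|S₁)_σ, H(V₂|S₂)_σ} − H(V₁⊕V₂|Y)_σ = α − 1 + h_b(τ)`. -/
theorem UCC_sum_rate_evaluation
    (θ τ : ℝ) (hθ : θ ∈ Set.Ico 0 (Real.pi/2)) (hτ : τ ∈ Set.Ioo (0:ℝ) (1/2)) :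
    -- H(V₁|S₁)_σ = h_b(τ)
    (margEntC2 (fun c => (c.2.2.1, c.2.2.2.2.2.1)) (sigma14 θ τ)
      - margEntC2 (fun c => c.2.2.2.2.2.1) (sigma14 θ τ) = hb τ)
    ∧
    -- H(V₂|S₂)_σ = h_b(τ)
    (margEntC2 (fun c => (c.2.2.2.1, c.2.2.2.2.2.2)) (sigma14 θ τ)
      - margEntC2 (fun c => c.2.2.2.2.2.2) (sigma14 θ τ) = hb τ)
    ∧
    -- min{H(V₁|S₁), H(V₂|S₂)} − H(W|Y) = α − 1 + h_b(τ)
    (min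
      (margEntC2 (fun c => (c.2.2.1, c.2.2.2.2.2.1)) (sigma14 θ τ)
        - margEntC2 (fun c => c.2.2.2.2.2.1) (sigma14 θ τ))
      (margEntC2 (fun c => (c.2.2.2.1, c.2.2.2.2.2.2)) (sigma14 θ τ)
        - margEntC2 (fun c => c.2.2.2.2.2.2) (sigma14 θ τ))
      - (margEntCQ2 (fun c => c.2.2.2.2.1) (sigma14 θ τ) - entQ2 (sigma14 θ τ))
      = alphaEx τ θ - 1 + hb τ) := by
  refine ⟨condEnt_fst θ τ, condEnt_snd θ τ, ?_⟩
  rw [condEnt_fst, condEnt_snd, min_self, margEntCQ2_sigma14, entQ2_sigma14, alphaEx]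
  ring
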